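/- arXiv:2509.16406 — 2 statements merged into one kernel-verified Lean document; each statement's English description precedes it below -/
import Mathlib

section
/- Let n ≥ 2 and 1 ≤ k ≤ n−1, and let F(A) = σ_n(A)/σ_{n−k}(A) for n×n real symmetric matrices A. For every δ̃ ∈ (0,1] there exists a constant ε₀ > 0 depending only on n, k, δ̃ with the following property. Let W = diag(λ₁,…,λ_n) with λ₁ ≥ λ₂ ≥ … ≥ λ_n > 0, set κ_α = 1/λ_α and F^{αα} = σ_{k−1}(κ|α)·κ_α²/σ_k(κ)². Then for every symmetric n×n real matrix ξ = (ξ_{αβ}): −(d²/dt²)|_{t=0} F(W + tξ) ≥ (1+ε₀)·F^{11}·ξ₁₁²/λ₁ + (1−δ̃)·Σ_{α≥2} F^{αα}·ξ_{αα}²/λ_α − (Σ_{α=1}^n F^{αα} ξ_{αα})²/F(W) + Σ_{α,γ≥2, α≠γ} F^{αα}·ξ_{αγ}²/λ_γ + (1 + (n−k)/(n−1))·Σ_{α≥2} F^{αα}·ξ_{α1}²/λ₁. -/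
open scoped Classical

noncomputable section

/-- The `j`-th elementary symmetric function of the family `κ` restricted to the
finite index set `s`; it is `1` for `j = 0`, and `0` for `j < 0` (or for `j`
larger than the cardinality of `s`). -/
def sigmaE {ι : Type*} (s : Finset ι) (j : ℤ) (κ : ι → ℝ) : ℝ :=
  if 0 ≤ j then ∑ t ∈ s.powersetCard j.toNat, ∏ i ∈ t, κ i else 0

/-- `σ_j(κ)`, the `j`-th elementary symmetric polynomial evaluated at `κ`. -/
def sigmaV {ι : Type*} [Fintype ι] (j : ℤ) (κ : ι → ℝ) : ℝ :=
  sigmaE Finset.univ j κ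

/-- `σ_j(κ|α)`: `σ_j` of `κ` with the `α`-th entry deleted. -/
def sigmaV1 {ι : Type*} [Fintype ι] [DecidableEq ι] (j : ℤ) (κ : ι → ℝ) (α : ι) : ℝ :=
  sigmaE (Finset.univ.erase α) j κ

/-- `σ_j(κ|αβ)`: `σ_j` of `κ` with the `α`-th and `β`-th entries deleted. -/
def sigmaV2 {ι : Type*} [Fintype ι] [DecidableEq ι] (j : ℤ) (κ : ι → ℝ) (α β : ι) : ℝ :=
  sigmaE ((Finset.univ.erase α).erase β) j κ

/-- `σ_j(A)` for a real `n × n` matrix `A`: the `j`-th elementary symmetric function of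
the eigenvalues of `A` when `A` is symmetric (= Hermitian over `ℝ`), junk value `0`
otherwise. -/
def sigmaMat {n : ℕ} (j : ℤ) (A : Matrix (Fin n) (Fin n) ℝ) : ℝ :=
  if h : A.IsHermitian then sigmaV j h.eigenvalues else 0

/-- The Hessian quotient operator `F(A) = σ_n(A)/σ_{n-k}(A)`. -/
def Fquot {n : ℕ} (k : ℕ) (A : Matrix (Fin n) (Fin n) ℝ) : ℝ :=
  sigmaMat (n : ℤ) A / sigmaMat ((n : ℤ) - (k : ℤ)) A

open Finset in
theorem two_mul_sum_powersetCard_two {ι : Type*} [DecidableEq ι] (s : Finset ι)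
    (f : Finset ι → ℝ) :
    2 * ∑ t ∈ s.powersetCard 2, f t = ∑ p ∈ s.offDiag, f {p.1, p.2} := by
  have hmaps : ∀ p ∈ s.offDiag, ({p.1, p.2} : Finset ι) ∈ s.powersetCard 2 := by
    intro p hp
    rw [mem_offDiag] at hp
    rw [mem_powersetCard]
    exact ⟨by simp [insert_subset_iff, hp.1, hp.2.1], card_pair hp.2.2⟩
  rw [← sum_fiberwise_of_maps_to hmaps, mul_sum]
  refine sum_congr rfl fun t ht => ?_
  obtain ⟨hts, hcard⟩ := mem_powersetCard.1 ht
  obtain ⟨a, b, hab, rfl⟩ := card_eq_two.1 hcard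
  have hfib : {p ∈ s.offDiag | ({p.1, p.2} : Finset ι) = {a, b}} = {(a, b), (b, a)} := by
    ext ⟨x, y⟩
    simp only [mem_filter, mem_offDiag, mem_insert, mem_singleton, Prod.mk.injEq]
    have ha : a ∈ s := hts (by simp)
    have hb : b ∈ s := hts (by simp)
    constructor
    · rintro ⟨⟨-, -, hxy⟩, h⟩
      have hx : x ∈ ({a, b} : Finset ι) := h ▸ by simp
      have hy : y ∈ ({a, b} : Finset ι) := h ▸ by simp
      grind
    · rintro (⟨rfl, rfl⟩ | ⟨rfl, rfl⟩)
      · exact ⟨⟨ha, hb, hab⟩, rfl⟩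
      · exact ⟨⟨hb, ha, hab.symm⟩, pair_comm _ _⟩
  rw [hfib, sum_pair (by simp [hab]), pair_comm b a, two_mul]

theorem det_submatrix_pair {ι : Type*} [Fintype ι] [DecidableEq ι] (M : Matrix ι ι ℝ)
    {i j : ι} (hij : i ≠ j) :
    (M.submatrix (Subtype.val : ({i, j} : Finset ι) → ι) Subtype.val).det =
      M i i * M j j - M i j * M j i := by
  let g : Fin 2 → ({i, j} : Finset ι) := ![⟨i, by simp⟩, ⟨j, by simp⟩]
  have hg : Function.Bijective g := by
    refine (Fintype.bijective_iff_injective_and_card g).2 ⟨?_, ?_⟩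
    · intro a b
      fin_cases a <;> fin_cases b <;> simp [g, hij, hij.symm]
    · rw [Fintype.card_fin, Fintype.card_coe, Finset.card_pair hij]
  rw [← Matrix.det_submatrix_equiv_self (Equiv.ofBijective g hg), Matrix.det_fin_two]
  simp [g]

open Finset Polynomial in
theorem two_mul_coeff_two_det_one_add_X_smul {ι : Type*} [Fintype ι] [DecidableEq ι]
    (M : Matrix ι ι ℝ) :
    2 * (Matrix.det (1 + (X : ℝ[X]) • M.map C)).coeff 2 =
      ∑ i, ∑ j, (M i i * M j j - M i j * M j i) := by
  rw [Matrix.coeff_det_one_add_X_smul_eq_sum_minors, two_mul_sum_powersetCard_two univ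
    (fun s => (M.submatrix (Subtype.val : s → ι) Subtype.val).det), ← sum_product',
    univ_product_univ]
  calc _ = ∑ p ∈ (univ : Finset ι).offDiag, (M p.1 p.1 * M p.2 p.2 - M p.1 p.2 * M p.2 p.1) :=
        sum_congr rfl fun p hp => det_submatrix_pair M (mem_offDiag.1 hp).2.2
    _ = _ := by
        refine sum_subset (subset_univ _) fun p _ hp => ?_
        have : p.1 = p.2 := by simpa using hp
        rw [this, sub_self]

open Finset in
theorem sigmaMat_eq_sum_minors {n : ℕ} {A : Matrix (Fin n) (Fin n) ℝ} (hA : A.IsHermitian)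
    (j : ℕ) (hj : j ≤ n) :
    sigmaMat (j : ℤ) A =
      ∑ s ∈ univ.powersetCard j, (A.submatrix (Subtype.val : s → Fin n) Subtype.val).det := by
  have hchar : A.charpoly = (Matrix.diagonal hA.eigenvalues).charpoly := by
    rw [hA.charpoly_eq, Matrix.charpoly_diagonal]
    rfl
  have h := congrArg (fun p => p.coeff (Fintype.card (Fin n) - j)) hchar
  rw [Matrix.charpoly_coeff_eq_sum_minors _ _ (by simpa using hj),
    Matrix.charpoly_coeff_eq_sum_minors _ _ (by simpa using hj)] at h
  rw [mul_left_cancel₀ (by simp) h]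
  simp only [sigmaMat, dif_pos hA, sigmaV, sigmaE, Nat.cast_nonneg, if_true, Int.toNat_natCast]
  refine sum_congr rfl fun s _ => ?_
  rw [Matrix.submatrix_diagonal _ _ Subtype.val_injective, Matrix.det_diagonal]
  exact (prod_coe_sort s _).symm

open Polynomial in
theorem iteratedDeriv_two_eval_div_eval (P Q : ℝ[X]) (hQ : Q.coeff 0 ≠ 0) :
    iteratedDeriv 2 (fun t : ℝ => P.eval t / Q.eval t) 0 =
      2 * P.coeff 2 / Q.coeff 0 - 2 * P.coeff 1 * Q.coeff 1 / Q.coeff 0 ^ 2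
        - P.coeff 0 * (2 * Q.coeff 2) / Q.coeff 0 ^ 2
        + 2 * P.coeff 0 * Q.coeff 1 ^ 2 / Q.coeff 0 ^ 3 := by
  have hQ0 : Q.eval 0 ≠ 0 := by rwa [← coeff_zero_eq_eval_zero]
  have hev : deriv (fun t : ℝ => P.eval t / Q.eval t) =ᶠ[nhds 0]
      fun t => (derivative P * Q - P * derivative Q).eval t / (Q ^ 2).eval t := by
    filter_upwards [Q.continuous.continuousAt.eventually_ne hQ0] with t ht
    refine ((P.hasDerivAt t).div (Q.hasDerivAt t) ht).deriv.trans ?_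
    simp
  rw [iteratedDeriv_succ, iteratedDeriv_one, hev.deriv_eq]
  refine ((derivative P * Q - P * derivative Q).hasDerivAt 0 |>.div ((Q ^ 2).hasDerivAt 0)
    (by simpa using hQ0)).deriv.trans ?_
  have h0 : ∀ R : ℝ[X], R.eval 0 = R.coeff 0 := fun R => (coeff_zero_eq_eval_zero R).symm
  have h1 : ∀ R : ℝ[X], (derivative R).coeff 0 = R.coeff 1 := fun R => by
    simp [coeff_derivative]
  have h2 : ∀ R : ℝ[X], (derivative R).coeff 1 = 2 * R.coeff 2 := fun R => by
    simp [coeff_derivative]; ring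
  simp only [derivative_sub, derivative_mul, derivative_pow, eval_sub, eval_add, eval_mul,
    eval_pow, eval_C]
  simp only [h0, h1, h2]
  field_simp
  ring

/-- The polynomial `det (1 + X M_V)`, where `M_V` is the principal submatrix of `M` on `V`. -/
def minorPoly {ι : Type*} [DecidableEq ι] (M : Matrix ι ι ℝ) (V : Finset ι) : Polynomial ℝ :=
  Matrix.det (1 + (Polynomial.X : Polynomial ℝ) •
    (M.submatrix (Subtype.val : V → ι) Subtype.val).map Polynomial.C)

section minorPoly

variable {ι : Type*} [DecidableEq ι] (M : Matrix ι ι ℝ) (V : Finset ι)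

theorem minorPoly_coeff_zero : (minorPoly M V).coeff 0 = 1 := by
  simp [minorPoly, Matrix.coeff_det_one_add_X_smul_eq_sum_minors]

theorem minorPoly_coeff_one : (minorPoly M V).coeff 1 = ∑ i ∈ V, M i i := by
  rw [minorPoly, Matrix.coeff_det_one_add_X_smul_one, ← Finset.sum_coe_sort]
  rfl

theorem two_mul_minorPoly_coeff_two :
    2 * (minorPoly M V).coeff 2 = ∑ i ∈ V, ∑ j ∈ V, (M i i * M j j - M i j * M j i) := by
  rw [minorPoly, two_mul_coeff_two_det_one_add_X_smul,
    ← Finset.sum_coe_sort V fun i => ∑ j ∈ V, (M i i * M j j - M i j * M j i)]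
  exact Finset.sum_congr rfl fun i _ =>
    Finset.sum_coe_sort V fun j => M i i * M j j - M i j * M j i

theorem minorPoly_eval (t : ℝ) :
    (minorPoly M V).eval t =
      Matrix.det (1 + t • M.submatrix (Subtype.val : V → ι) Subtype.val) := by
  rw [minorPoly, ← Polynomial.coe_evalRingHom, RingHom.map_det]
  congr 1
  ext i j
  by_cases h : i = j <;> simp [h, mul_comm t]

theorem det_submatrix_diagonal_add_smul {lam : ι → ℝ} (hlam : ∀ i, 0 < lam i)
    (ξ : Matrix ι ι ℝ) (t : ℝ) :
    ((Matrix.diagonal lam + t • ξ).submatrix (Subtype.val : V → ι) Subtype.val).det =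
      (∏ i ∈ V, lam i) * (minorPoly (Matrix.of fun i j => (lam i)⁻¹ * ξ i j) V).eval t := by
  rw [minorPoly_eval, ← Finset.prod_coe_sort, ← Matrix.det_diagonal, ← Matrix.det_mul]
  congr 1
  ext i j
  rw [Matrix.diagonal_mul]
  have := (hlam i).ne'
  by_cases h : i = j
  · subst h
    simp only [Matrix.submatrix_apply, Matrix.add_apply, Matrix.diagonal_apply_eq,
      Matrix.smul_apply, smul_eq_mul, Matrix.one_apply_eq, Matrix.of_apply]
    field_simp
  · have h' : (i : ι) ≠ j := fun e => h (Subtype.ext e)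
    simp only [Matrix.submatrix_apply, Matrix.add_apply, Matrix.diagonal_apply_ne _ h',
      Matrix.smul_apply, smul_eq_mul, Matrix.one_apply_ne h, Matrix.of_apply]
    field_simp
    ring

end minorPoly

section sigmaPoly

variable {n : ℕ} (κ : Fin n → ℝ) (ξ : Matrix (Fin n) (Fin n) ℝ)

/-- The polynomial `t ↦ σ_{n-k}(W + tξ) / σ_n(W)` for `W = diag(κ)⁻¹`. -/
def sigmaPoly (k : ℕ) : Polynomial ℝ :=
  ∑ T ∈ (Finset.univ : Finset (Fin n)).powersetCard k,
    Polynomial.C (∏ i ∈ T, κ i) * minorPoly (Matrix.of fun i j => κ i * ξ i j) Tᶜ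

theorem sigmaMat_diagonal_add_smul {lam : Fin n → ℝ} (hlam : ∀ i, 0 < lam i)
    (hξ : ξ.IsSymm) {k : ℕ} (hk : k ≤ n) (t : ℝ) :
    sigmaMat ((n : ℤ) - (k : ℤ)) (Matrix.diagonal lam + t • ξ) =
      (∏ i, lam i) * (sigmaPoly (fun i => (lam i)⁻¹) ξ k).eval t := by
  have hherm : (Matrix.diagonal lam + t • ξ).IsHermitian := by
    refine Matrix.IsHermitian.ext fun i j => ?_
    have := hξ.apply i j
    by_cases h : i = j
    · subst h; simp
    · simp [h, Ne.symm h, this]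
  rw [← Nat.cast_sub hk, sigmaMat_eq_sum_minors hherm _ (Nat.sub_le _ _), sigmaPoly,
    Polynomial.eval_finsetSum, Finset.mul_sum]
  refine Finset.sum_nbij' (fun V => Vᶜ) (fun T => Tᶜ) ?_ ?_ ?_ ?_ ?_
  · intro V hV
    have := Finset.mem_powersetCard.1 hV
    simp [Finset.mem_powersetCard, Finset.card_compl, this.2, Nat.sub_sub_self hk]
  · intro V hV
    have := Finset.mem_powersetCard.1 hV
    simp [Finset.mem_powersetCard, Finset.card_compl, this.2]
  · simp
  · simp
  · intro V _
    rw [det_submatrix_diagonal_add_smul V hlam, Polynomial.eval_mul, Polynomial.eval_C, compl_compl,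
      ← mul_assoc, ← Finset.prod_mul_prod_compl V lam, mul_assoc (∏ i ∈ V, lam i),
      ← Finset.prod_mul_distrib,
      Finset.prod_eq_one fun i _ => mul_inv_cancel₀ (hlam i).ne', mul_one]

theorem Fquot_diagonal_add_smul {lam : Fin n → ℝ} (hlam : ∀ i, 0 < lam i)
    (hξ : ξ.IsSymm) {k : ℕ} (hk : k ≤ n) (t : ℝ) :
    Fquot k (Matrix.diagonal lam + t • ξ) =
      (sigmaPoly (fun i => (lam i)⁻¹) ξ 0).eval t / (sigmaPoly (fun i => (lam i)⁻¹) ξ k).eval t := by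
  have h0 := sigmaMat_diagonal_add_smul ξ hlam hξ (Nat.zero_le n) t
  rw [Nat.cast_zero, sub_zero] at h0
  rw [Fquot, h0, sigmaMat_diagonal_add_smul ξ hlam hξ hk,
    mul_div_mul_left _ _ (Finset.prod_pos fun i _ => hlam i).ne']

theorem sigmaPoly_coeff_zero (k : ℕ) :
    (sigmaPoly κ ξ k).coeff 0 = ∑ T ∈ Finset.univ.powersetCard k, ∏ i ∈ T, κ i := by
  simp only [sigmaPoly, Polynomial.finsetSum_coeff, Polynomial.coeff_C_mul, minorPoly_coeff_zero,
    mul_one]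

theorem sigmaPoly_coeff_one (k : ℕ) :
    (sigmaPoly κ ξ k).coeff 1 = ∑ T ∈ Finset.univ.powersetCard k,
      (∏ i ∈ T, κ i) * (∑ i, κ i * ξ i i - ∑ i ∈ T, κ i * ξ i i) := by
  simp only [sigmaPoly, Polynomial.finsetSum_coeff, Polynomial.coeff_C_mul, minorPoly_coeff_one]
  refine Finset.sum_congr rfl fun T _ => ?_
  rw [← Finset.sum_add_sum_compl T, add_sub_cancel_left]
  rfl

theorem two_mul_sigmaPoly_coeff_two (hξ : ξ.IsSymm) (k : ℕ) :
    2 * (sigmaPoly κ ξ k).coeff 2 = ∑ T ∈ Finset.univ.powersetCard k,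
      (∏ i ∈ T, κ i) * ((∑ i, κ i * ξ i i - ∑ i ∈ T, κ i * ξ i i) ^ 2
        - ∑ i, ∑ j, κ i * κ j * ξ i j ^ 2
        + ∑ i, ∑ j, if i ∈ T ∨ j ∈ T then κ i * κ j * ξ i j ^ 2 else 0) := by
  simp only [sigmaPoly, Polynomial.finsetSum_coeff, Polynomial.coeff_C_mul, Finset.mul_sum]
  refine Finset.sum_congr rfl fun T _ => ?_
  rw [mul_left_comm, two_mul_minorPoly_coeff_two]
  congr 1
  simp only [Finset.sum_sub_distrib, Matrix.of_apply]
  rw [← Finset.sum_mul_sum, ← sq, ← Finset.sum_add_sum_compl T (fun i => κ i * ξ i i),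
    add_sub_cancel_left, sub_add, ← Finset.sum_sub_distrib]
  congr 1
  rw [← Finset.sum_filter_add_sum_filter_not Finset.univ (fun i => i ∈ T)]
  simp only [← Finset.sum_sub_distrib]
  have hz : ∑ i with i ∈ T, ∑ j, (κ i * κ j * ξ i j ^ 2
      - if i ∈ T ∨ j ∈ T then κ i * κ j * ξ i j ^ 2 else 0) = 0 :=
    Finset.sum_eq_zero fun i hi => Finset.sum_eq_zero fun j _ => by
      simp [(Finset.mem_filter.1 hi).2]
  rw [hz, zero_add, show ({i | i ∉ T} : Finset (Fin n)) = Tᶜ by ext; simp]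
  refine Finset.sum_congr rfl fun i hi => ?_
  rw [← Finset.sum_filter_add_sum_filter_not Finset.univ (fun j => j ∈ T)]
  rw [Finset.sum_eq_zero (s := {j | j ∈ T}) fun j hj => by simp [(Finset.mem_filter.1 hj).2],
    zero_add, show ({i | i ∉ T} : Finset (Fin n)) = Tᶜ by ext; simp]
  refine Finset.sum_congr rfl fun j hj => ?_
  rw [Finset.mem_compl] at hi hj
  rw [if_neg (by tauto), hξ.apply i j]
  ring

end sigmaPoly

theorem neg_iteratedDeriv_two_Fquot {n k : ℕ} (hk : k ≤ n) {lam : Fin n → ℝ}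
    (hlam : ∀ i, 0 < lam i) {ξ : Matrix (Fin n) (Fin n) ℝ} (hξ : ξ.IsSymm) {κ : Fin n → ℝ}
    (hκ : κ = fun i => (lam i)⁻¹) {S : ℝ}
    (hS : S = ∑ T ∈ Finset.univ.powersetCard k, ∏ i ∈ T, κ i) (hS0 : 0 < S) :
    -iteratedDeriv 2 (fun t : ℝ => Fquot k (Matrix.diagonal lam + t • ξ)) 0 =
      (∑ T ∈ Finset.univ.powersetCard k, (∏ i ∈ T, κ i) * (∑ i ∈ T, κ i * ξ i i) ^ 2
        - 2 * (∑ T ∈ Finset.univ.powersetCard k,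
            (∏ i ∈ T, κ i) * ∑ i ∈ T, κ i * ξ i i) ^ 2 / S
        + ∑ T ∈ Finset.univ.powersetCard k, (∏ i ∈ T, κ i) *
            ∑ i, ∑ j, if i ∈ T ∨ j ∈ T then κ i * κ j * ξ i j ^ 2 else 0) / S ^ 2 := by
  subst hκ
  set κ : Fin n → ℝ := fun i => (lam i)⁻¹ with hκ
  simp only [Fquot_diagonal_add_smul ξ hlam hξ hk]
  rw [iteratedDeriv_two_eval_div_eval _ _ (by rw [sigmaPoly_coeff_zero, ← hS]; exact hS0.ne')]
  have hb0 := sigmaPoly_coeff_zero κ ξ k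
  have hb1 := sigmaPoly_coeff_one κ ξ k
  have hb2 := two_mul_sigmaPoly_coeff_two κ ξ hξ k
  have ha0 := sigmaPoly_coeff_zero κ ξ 0
  have ha1 := sigmaPoly_coeff_one κ ξ 0
  have ha2 := two_mul_sigmaPoly_coeff_two κ ξ hξ 0
  simp only [Finset.powersetCard_zero, Finset.sum_singleton, Finset.prod_empty,
    Finset.sum_empty, Finset.notMem_empty, or_self, if_false, Finset.sum_const_zero, one_mul,
    sub_zero, add_zero] at ha0 ha1 ha2
  rw [← hS] at hb0
  rw [hb0, hb1, hb2, ha0, ha1, ha2]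
  set H := ∑ i, κ i * ξ i i
  set D := ∑ i, ∑ j, κ i * κ j * ξ i j ^ 2
  set P := ∑ T ∈ Finset.univ.powersetCard k, (∏ i ∈ T, κ i) * ∑ i ∈ T, κ i * ξ i i with hP
  have e1 : ∑ T ∈ Finset.univ.powersetCard k,
      (∏ i ∈ T, κ i) * (H - ∑ i ∈ T, κ i * ξ i i) = H * S - P := by
    rw [hS, hP, Finset.mul_sum, ← Finset.sum_sub_distrib]
    exact Finset.sum_congr rfl fun T _ => by ring
  have e2 : ∑ T ∈ Finset.univ.powersetCard k,
      (∏ i ∈ T, κ i) * ((H - ∑ i ∈ T, κ i * ξ i i) ^ 2 - D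
        + ∑ i, ∑ j, if i ∈ T ∨ j ∈ T then κ i * κ j * ξ i j ^ 2 else 0) =
      (H ^ 2 - D) * S - 2 * H * P
        + ∑ T ∈ Finset.univ.powersetCard k, (∏ i ∈ T, κ i) * (∑ i ∈ T, κ i * ξ i i) ^ 2
        + ∑ T ∈ Finset.univ.powersetCard k, (∏ i ∈ T, κ i) *
            ∑ i, ∑ j, if i ∈ T ∨ j ∈ T then κ i * κ j * ξ i j ^ 2 else 0 := by
    rw [hS, hP, Finset.mul_sum, Finset.mul_sum, ← Finset.sum_sub_distrib,
      ← Finset.sum_add_distrib, ← Finset.sum_add_distrib]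
    exact Finset.sum_congr rfl fun T _ => by ring
  rw [e1, e2]
  have := hS0.ne'
  field_simp
  ring

open Finset in
theorem sum_sum_eq_diag_add_offDiag {ι : Type*} [Fintype ι] [DecidableEq ι] (a : ι)
    (f : ι → ι → ℝ) :
    ∑ i, ∑ j, f i j = f a a + ∑ i ∈ univ.erase a, f i i
      + ∑ i ∈ univ.erase a, ∑ j ∈ (univ.erase a).erase i, f i j
      + ∑ i ∈ univ.erase a, (f i a + f a i) := by
  have hrow : ∀ g : ι → ℝ, ∑ j, g j = g a + ∑ j ∈ univ.erase a, g j := fun g =>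
    (add_sum_erase _ _ (mem_univ a)).symm
  rw [hrow, hrow (f a)]
  have : ∑ i ∈ univ.erase a, ∑ j, f i j = ∑ i ∈ univ.erase a, (f i a + (f i i
      + ∑ j ∈ (univ.erase a).erase i, f i j)) := by
    refine sum_congr rfl fun i hi => ?_
    rw [hrow, add_sum_erase _ _ hi]
  rw [this]
  simp only [sum_add_distrib]
  ring

open Finset in
theorem sigmaV1_mul_eq_sum {ι : Type*} [Fintype ι] [DecidableEq ι] (κ : ι → ℝ) (α : ι) {k : ℕ}
    (hk : 1 ≤ k) :
    sigmaV1 ((k : ℤ) - 1) κ α * κ α =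
      ∑ T ∈ univ.powersetCard k, if α ∈ T then ∏ i ∈ T, κ i else 0 := by
  obtain ⟨m, rfl⟩ : ∃ m, k = m + 1 := ⟨k - 1, by omega⟩
  have hins : (univ : Finset ι) = insert α (univ.erase α) := (insert_erase (mem_univ α)).symm
  have hnot : ∀ {m : ℕ} {T}, T ∈ (univ.erase α).powersetCard m → α ∉ T := fun hT h =>
    notMem_erase α univ ((mem_powersetCard.1 hT).1 h)
  rw [hins, powersetCard_succ_insert (notMem_erase α univ), sum_union, sum_image,
    sum_eq_zero (s := powersetCard (m + 1) _) fun T hT => if_neg (hnot hT), zero_add]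
  · simp only [sigmaV1, sigmaE, Nat.cast_add, Nat.cast_one, add_sub_cancel_right,
      Nat.cast_nonneg, if_true, Int.toNat_natCast, sum_mul]
    refine sum_congr rfl fun T hT => ?_
    rw [if_pos (mem_insert_self _ _), prod_insert (hnot hT), mul_comm]
  · intro T hT T' hT' h
    rw [← erase_insert (hnot hT), ← erase_insert (hnot hT')]
    exact congrArg (fun s => s.erase α) h
  · refine disjoint_left.2 fun T hT hT' => ?_
    obtain ⟨T', _, rfl⟩ := mem_image.1 hT'
    exact hnot hT (mem_insert_self _ _)

open Finset in
/-- Variance bound: the mass carried by the smallest weight is controlled by the variance of the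
subset sums together with the contributions of the other indices. -/
theorem smallest_weight_le_variance {ι : Type*} [Fintype ι] [DecidableEq ι] {k : ℕ}
    (hk : k < Fintype.card ι) {κ : ι → ℝ} (hκ : ∀ i, 0 < κ i) {a : ι}
    (ha : ∀ i, κ a ≤ κ i) (η q : ι → ℝ)
    (hq : ∀ i, q i = ∑ T ∈ univ.powersetCard k, if i ∈ T then ∏ i ∈ T, κ i else 0) {S : ℝ}
    (hS : S = ∑ T ∈ univ.powersetCard k, ∏ i ∈ T, κ i) (hS0 : 0 < S) :
    q a * η a ^ 2 ≤ (Fintype.card ι).choose k *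
      (8 * (∑ T ∈ univ.powersetCard k, (∏ i ∈ T, κ i) * (∑ i ∈ T, η i) ^ 2
          - (∑ T ∈ univ.powersetCard k, (∏ i ∈ T, κ i) * ∑ i ∈ T, η i) ^ 2 / S)
        + 2 * ∑ i ∈ univ.erase a, q i * η i ^ 2) := by
  set w : Finset ι → ℝ := fun T => ∏ i ∈ T, κ i with hw
  have hw0 : ∀ T, 0 ≤ w T := fun T => prod_nonneg fun i _ => (hκ i).le
  set P := ∑ T ∈ univ.powersetCard k, w T * ∑ i ∈ T, η i with hP
  set V := ∑ T ∈ univ.powersetCard k, w T * (∑ i ∈ T, η i) ^ 2 - P ^ 2 / S with hV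
  have hVeq : V = ∑ T ∈ univ.powersetCard k, w T * (∑ i ∈ T, η i - P / S) ^ 2 := by
    have : ∑ T ∈ univ.powersetCard k, w T * (∑ i ∈ T, η i - P / S) ^ 2 =
        ∑ T ∈ univ.powersetCard k, w T * (∑ i ∈ T, η i) ^ 2 - 2 * (P / S) * P
          + (P / S) ^ 2 * S := by
      conv_rhs => rw [hS, hP, mul_sum, mul_sum, ← sum_sub_distrib, ← sum_add_distrib]
      rw [← hP, ← hS]
      exact sum_congr rfl fun T _ => by ring
    rw [this, hV]
    have := hS0.ne'
    field_simp
    ring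
  have hterm : ∀ T ∈ univ.powersetCard k, w T * (∑ i ∈ T, η i - P / S) ^ 2 ≤ V := by
    intro T hT
    rw [hVeq]
    exact single_le_sum (f := fun T => w T * (∑ i ∈ T, η i - P / S) ^ 2)
      (fun T _ => mul_nonneg (hw0 T) (sq_nonneg _)) hT
  have hV0 : 0 ≤ V := by
    rw [hVeq]
    exact sum_nonneg fun T _ => mul_nonneg (hw0 T) (sq_nonneg _)
  have hq0 : ∀ i, 0 ≤ q i := fun i => by
    rw [hq]
    exact sum_nonneg fun T _ => by split_ifs; exacts [hw0 T, le_rfl]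
  have hqle : ∀ T ∈ univ.powersetCard k, ∀ i ∈ T, w T ≤ q i := by
    intro T hT i hi
    rw [hq]
    refine le_trans (by simp [hi, hw]) (single_le_sum (f := fun T => if i ∈ T then w T else 0)
      (fun T _ => by split_ifs; exacts [hw0 T, le_rfl]) hT)
  set R := ∑ i ∈ univ.erase a, q i * η i ^ 2 with hR
  have hR0 : 0 ≤ R := sum_nonneg fun i _ => mul_nonneg (hq0 i) (sq_nonneg _)
  have hmain : ∀ T ∈ univ.powersetCard k,
      (if a ∈ T then w T else 0) * η a ^ 2 ≤ 8 * V + 2 * R := by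
    intro T hT
    split_ifs with haT
    swap
    · rw [zero_mul]; positivity
    have hcard := (mem_powersetCard.1 hT).2
    obtain ⟨j, hj⟩ : ∃ j, j ∉ T := by
      by_contra! h
      rw [eq_univ_iff_forall.2 h, card_univ] at hcard
      omega
    have hja : j ≠ a := fun h => hj (h ▸ haT)
    have hj' : j ∉ T.erase a := fun h => hj (mem_of_mem_erase h)
    set T' := insert j (T.erase a) with hT'
    have hT'mem : T' ∈ univ.powersetCard k := by
      rw [mem_powersetCard]
      refine ⟨subset_univ _, ?_⟩
      rw [hT', card_insert_of_notMem hj', card_erase_of_mem haT]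
      have := card_pos.2 ⟨a, haT⟩
      omega
    have hwle : w T ≤ w T' := by
      simp only [hw, hT']
      rw [prod_insert hj', ← mul_prod_erase T κ haT]
      exact mul_le_mul_of_nonneg_right (ha j) (hw0 _)
    have hdiff : η a = (∑ i ∈ T, η i - P / S) - (∑ i ∈ T', η i - P / S) + η j := by
      rw [hT', sum_insert hj', ← add_sum_erase T η haT]
      ring
    have h1 := hterm T hT
    have h2 := (mul_le_mul_of_nonneg_right hwle (sq_nonneg _)).trans (hterm T' hT'mem)
    have h3 : w T * η j ^ 2 ≤ R :=
      (mul_le_mul_of_nonneg_right (hwle.trans (hqle T' hT'mem j (mem_insert_self _ _)))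
        (sq_nonneg _)).trans (single_le_sum (f := fun i => q i * η i ^ 2)
          (fun i _ => mul_nonneg (hq0 i) (sq_nonneg _)) (mem_erase.2 ⟨hja, mem_univ j⟩))
    set x := ∑ i ∈ T, η i - P / S
    set y := ∑ i ∈ T', η i - P / S
    have h4 : η a ^ 2 ≤ 4 * x ^ 2 + 4 * y ^ 2 + 2 * η j ^ 2 := by
      rw [hdiff]
      nlinarith [sq_nonneg (x + y), sq_nonneg (x - y - η j)]
    nlinarith [mul_le_mul_of_nonneg_left h4 (hw0 T)]
  calc q a * η a ^ 2 = ∑ T ∈ univ.powersetCard k, (if a ∈ T then w T else 0) * η a ^ 2 := by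
        rw [hq, sum_mul]
    _ ≤ ∑ T ∈ (univ : Finset ι).powersetCard k, (8 * V + 2 * R) := sum_le_sum hmain
    _ = _ := by rw [sum_const, card_powersetCard, nsmul_eq_mul, card_univ]

/-- Theorem 1.1, special concavity of the Hessian quotient
`F = σ_n/σ_{n-k}`: for `n ≥ 2`, `1 ≤ k ≤ n-1` and `0 < δ̃ ≤ 1` there is `ε₀ > 0`
depending only on `n, k, δ̃` such that for every diagonal `W = diag(λ)` with
`λ₁ ≥ ⋯ ≥ λ_n > 0` and every symmetric `ξ` the refined concavity inequality holds. -/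
theorem stmt_0 (n k : ℕ) (hn : 2 ≤ n) (hk1 : 1 ≤ k) (hk2 : k ≤ n - 1)
    (δt : ℝ) (hδt : 0 < δt) (hδt' : δt ≤ 1) :
    ∃ ε₀ : ℝ, 0 < ε₀ ∧
      ∀ lam : Fin n → ℝ, (∀ α, 0 < lam α) → (∀ α β : Fin n, α ≤ β → lam β ≤ lam α) →
      ∀ ξ : Matrix (Fin n) (Fin n) ℝ, ξ.IsSymm →
        let i0 : Fin n := ⟨0, by omega⟩
        let W : Matrix (Fin n) (Fin n) ℝ := Matrix.diagonal lam
        let κ : Fin n → ℝ := fun α => (lam α)⁻¹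
        let Fd : Fin n → ℝ := fun α => sigmaV1 ((k : ℤ) - 1) κ α * (κ α) ^ 2 / (sigmaV (k : ℤ) κ) ^ 2
        (-(iteratedDeriv 2 (fun t : ℝ => Fquot k (W + t • ξ)) 0)) ≥
          (1 + ε₀) * Fd i0 * (ξ i0 i0) ^ 2 / lam i0
          + (1 - δt) * ∑ α ∈ Finset.univ.erase i0, Fd α * (ξ α α) ^ 2 / lam α
          - (∑ α, Fd α * ξ α α) ^ 2 / Fquot k W
          + ∑ α ∈ Finset.univ.erase i0, ∑ γ ∈ (Finset.univ.erase i0).erase α,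
              Fd α * (ξ α γ) ^ 2 / lam γ
          + (1 + ((n : ℝ) - (k : ℝ)) / ((n : ℝ) - 1)) *
              ∑ α ∈ Finset.univ.erase i0, Fd α * (ξ α i0) ^ 2 / lam i0 := by
  have hkn : k < n := by omega
  have hC : (0 : ℝ) < n.choose k := by exact_mod_cast Nat.choose_pos hkn.le
  refine ⟨δt / (8 * n.choose k), by positivity, ?_⟩
  intro lam hlam hmono ξ hξ i0 W κ Fd
  set ε : ℝ := δt / (8 * n.choose k) with hε
  have hκ : ∀ i, 0 < κ i := fun i => inv_pos.2 (hlam i)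
  have hκmin : ∀ i, κ i0 ≤ κ i := fun i =>
    inv_anti₀ (hlam i) (hmono i0 i (Fin.mk_le_of_le_val (Nat.zero_le _)))
  let w : Finset (Fin n) → ℝ := fun T => ∏ i ∈ T, κ i
  have hw : ∀ T, 0 < w T := fun T => Finset.prod_pos fun i _ => hκ i
  let η : Fin n → ℝ := fun i => κ i * ξ i i
  let d : Fin n → Fin n → ℝ := fun i j => κ i * κ j * ξ i j ^ 2
  have hd : ∀ i j, 0 ≤ d i j := fun i j =>
    mul_nonneg (mul_nonneg (hκ i).le (hκ j).le) (sq_nonneg _)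
  let q : Fin n → ℝ := fun α => ∑ T ∈ Finset.univ.powersetCard k, if α ∈ T then w T else 0
  obtain ⟨S, hS⟩ : ∃ S, S = ∑ T ∈ (Finset.univ : Finset (Fin n)).powersetCard k, w T := ⟨_, rfl⟩
  have hS0 : 0 < S := by
    rw [hS]
    exact Finset.sum_pos (fun T _ => hw T) (Finset.powersetCard_nonempty.2 (by simpa using hkn.le))
  have hSσ : sigmaV (k : ℤ) κ = S := by simp [sigmaV, sigmaE, hS, w]
  have hFd : ∀ α, Fd α = q α * κ α / S ^ 2 := fun α => by
    simp only [Fd, hSσ, q, w, ← sigmaV1_mul_eq_sum κ α hk1]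
    ring
  have hFW : Fquot k W = 1 / S := by
    have h := Fquot_diagonal_add_smul ξ hlam hξ hkn.le 0
    rw [zero_smul, add_zero, ← Polynomial.coeff_zero_eq_eval_zero,
      ← Polynomial.coeff_zero_eq_eval_zero, sigmaPoly_coeff_zero, sigmaPoly_coeff_zero] at h
    rw [h, hS]
    simp [w, κ]
  obtain ⟨P, hP⟩ : ∃ P, P = ∑ T ∈ Finset.univ.powersetCard k, w T * ∑ i ∈ T, η i := ⟨_, rfl⟩
  have hPq : ∑ α, q α * η α = P := by
    simp only [hP, q, Finset.sum_mul, Finset.mul_sum]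
    rw [Finset.sum_comm]
    refine Finset.sum_congr rfl fun T _ => ?_
    simp [ite_mul, Finset.sum_ite_mem]
  obtain ⟨A, hA⟩ : ∃ A, A = ∑ T ∈ Finset.univ.powersetCard k, w T * (∑ i ∈ T, η i) ^ 2 :=
    ⟨_, rfl⟩
  let r : Fin n → Fin n → ℝ := fun i j =>
    ∑ T ∈ Finset.univ.powersetCard k, if i ∈ T ∨ j ∈ T then w T else 0
  obtain ⟨B, hB⟩ : ∃ B, B = ∑ T ∈ Finset.univ.powersetCard k,
      w T * ∑ i, ∑ j, if i ∈ T ∨ j ∈ T then d i j else 0 := ⟨_, rfl⟩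
  have hBr : B = ∑ i, ∑ j, r i j * d i j := by
    simp only [hB, r, Finset.sum_mul, Finset.mul_sum]
    rw [Finset.sum_comm]
    refine Finset.sum_congr rfl fun i _ => ?_
    rw [Finset.sum_comm]
    exact Finset.sum_congr rfl fun j _ => Finset.sum_congr rfl fun T _ => by split_ifs <;> simp
  have hr1 : ∀ i j, q i * d i j ≤ r i j * d i j := fun i j => by
    refine mul_le_mul_of_nonneg_right (Finset.sum_le_sum fun T _ => ?_) (hd i j)
    have := (hw T).le
    by_cases h : i ∈ T <;> by_cases h' : j ∈ T <;> simp [h, h', this]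
  have hr2 : ∀ i j, q j * d i j ≤ r i j * d i j := fun i j => by
    refine mul_le_mul_of_nonneg_right (Finset.sum_le_sum fun T _ => ?_) (hd i j)
    have := (hw T).le
    by_cases h : i ∈ T <;> by_cases h' : j ∈ T <;> simp [h, h', this]
  have hdη : ∀ i, d i i = η i ^ 2 := fun i => by simp only [d, η]; ring
  have hq0 : ∀ i, 0 ≤ q i := fun i => Finset.sum_nonneg fun T _ => by
    split_ifs
    exacts [(hw T).le, le_rfl]
  obtain ⟨c, hc⟩ : ∃ c, c = 1 + ((n : ℝ) - (k : ℝ)) / ((n : ℝ) - 1) := ⟨_, rfl⟩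
  have hc2 : c ≤ 2 := by
    have h1 : (2 : ℝ) ≤ n := by exact_mod_cast hn
    have h2 : (1 : ℝ) ≤ k := by exact_mod_cast hk1
    have : ((n : ℝ) - k) / ((n : ℝ) - 1) ≤ 1 := by
      rw [div_le_one (by linarith)]
      linarith
    linarith
  have hBge : q i0 * η i0 ^ 2 + ∑ α ∈ Finset.univ.erase i0, q α * η α ^ 2
      + ∑ α ∈ Finset.univ.erase i0, ∑ γ ∈ (Finset.univ.erase i0).erase α, q α * d α γ
      + c * ∑ α ∈ Finset.univ.erase i0, q α * d α i0 ≤ B := by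
    rw [hBr, sum_sum_eq_diag_add_offDiag i0]
    refine add_le_add (add_le_add (add_le_add ?_ (Finset.sum_le_sum fun i _ => ?_))
      (Finset.sum_le_sum fun i _ => Finset.sum_le_sum fun j _ => hr1 i j)) ?_
    · rw [← hdη]; exact hr1 _ _
    · rw [← hdη]; exact hr1 _ _
    · rw [Finset.mul_sum]
      refine Finset.sum_le_sum fun i _ => ?_
      have hsymm : d i0 i = d i i0 := by simp only [d, hξ.apply i i0]; ring
      have h1 := hr1 i i0
      have h2 := hr2 i0 i
      rw [hsymm] at h2
      rw [hsymm]
      nlinarith [mul_nonneg (hq0 i) (hd i i0)]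
  have hvar := smallest_weight_le_variance (k := k) (by simpa using hkn) hκ hκmin η q
    (fun i => rfl) hS hS0
  rw [Fintype.card_fin] at hvar
  change q i0 * η i0 ^ 2 ≤ n.choose k * (8 * (∑ T ∈ Finset.univ.powersetCard k,
    w T * (∑ i ∈ T, η i) ^ 2 - (∑ T ∈ Finset.univ.powersetCard k, w T * ∑ i ∈ T, η i) ^ 2 / S)
    + _) at hvar
  rw [← hA, ← hP] at hvar
  have hV0 : 0 ≤ A - P ^ 2 / S := by
    rw [sub_nonneg, div_le_iff₀ hS0, hP, hA, hS, mul_comm]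
    refine Finset.sum_sq_le_sum_mul_sum_of_sq_le_mul _ (fun T _ => (hw T).le)
      (fun T _ => mul_nonneg (hw T).le (sq_nonneg _)) fun T _ => le_of_eq ?_
    ring
  obtain ⟨R, hR⟩ : ∃ R, R = ∑ α ∈ Finset.univ.erase i0, q α * η α ^ 2 := ⟨_, rfl⟩
  have hR0 : 0 ≤ R := by
    rw [hR]
    exact Finset.sum_nonneg fun i _ => mul_nonneg (hq0 i) (sq_nonneg _)
  rw [← hR] at hvar hBge
  have hε' : ε * (q i0 * η i0 ^ 2) ≤ (A - P ^ 2 / S) + δt * R := by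
    have h := mul_le_mul_of_nonneg_left hvar (show 0 ≤ ε by positivity)
    have he : ε * (n.choose k * (8 * (A - P ^ 2 / S) + 2 * R)) =
        δt * (A - P ^ 2 / S) + δt * R / 4 := by
      rw [hε]
      field_simp
      ring
    rw [he] at h
    nlinarith [mul_nonneg (sub_nonneg.2 hδt') hV0, mul_nonneg hδt.le hR0]
  have hderiv := neg_iteratedDeriv_two_Fquot (κ := κ) hkn.le hlam hξ rfl hS hS0
  change _ = (∑ T ∈ Finset.univ.powersetCard k, w T * (∑ i ∈ T, η i) ^ 2
    - 2 * (∑ T ∈ Finset.univ.powersetCard k, w T * ∑ i ∈ T, η i) ^ 2 / S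
    + ∑ T ∈ Finset.univ.powersetCard k,
      w T * ∑ i, ∑ j, if i ∈ T ∨ j ∈ T then d i j else 0) / S ^ 2 at hderiv
  rw [← hA, ← hP, ← hB] at hderiv
  have hterm : ∀ α γ, Fd α * ξ α γ ^ 2 / lam γ = q α * d α γ / S ^ 2 := fun α γ => by
    rw [hFd]
    simp only [d, κ]
    ring
  have hsumP : ∑ α, Fd α * ξ α α = P / S ^ 2 := by
    rw [← hPq, Finset.sum_div]
    refine Finset.sum_congr rfl fun α _ => ?_
    rw [hFd]
    simp only [η]
    ring
  rw [ge_iff_le, hderiv, mul_assoc, mul_div_assoc, hsumP, hFW, ← hc]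
  simp only [hterm, hdη, ← Finset.sum_div, ← hR]
  have hfin : (1 + ε) * (q i0 * η i0 ^ 2) + (1 - δt) * R - P ^ 2 / S
      + ∑ α ∈ Finset.univ.erase i0, ∑ γ ∈ (Finset.univ.erase i0).erase α, q α * d α γ
      + c * ∑ α ∈ Finset.univ.erase i0, q α * d α i0 ≤ A - 2 * P ^ 2 / S + B := by
    have : 2 * P ^ 2 / S = P ^ 2 / S + P ^ 2 / S := by ring
    linarith
  refine le_trans (le_of_eq ?_) (div_le_div_of_nonneg_right hfin (sq_nonneg S))
  have := hS0.ne'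
  field_simp
end
end

section
/- Let n ≥ 2, 1 ≤ k ≤ n−1, and F(A) = σ_n(A)/σ_{n−k}(A). Let W = diag(λ₁,…,λ_n) with all λ_α > 0 and set κ_α = 1/λ_α. Then for every symmetric n×n real matrix ξ: σ_k(κ)²·(d²/dt²)|_{t=0} F(W + tξ) = −Σ_{α≠γ} σ_{k−2}(κ|αγ)·κ_α²κ_γ²·(ξ_{αα}ξ_{γγ} − ξ_{αγ}²) − 2·Σ_{α,γ=1}^n σ_{k−1}(κ|α)·κ_α²κ_γ·ξ_{αγ}² + 2·(Σ_{α=1}^n σ_{k−1}(κ|α)·κ_α²·ξ_{αα})²/σ_k(κ). -/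
open scoped Classical

noncomputable section

open Polynomial in
lemma Matrix.two_mul_coeff_det_one_add_X_smul_two {R ι : Type*} [CommRing R] [Fintype ι]
    [DecidableEq ι] (M : Matrix ι ι R) :
    2 * (Matrix.det (1 + (X : R[X]) • M.map C)).coeff 2 = M.trace ^ 2 - (M * M).trace := by
  set p := Matrix.det (1 + (X : R[X]) • M.map C) with hp
  set q := Matrix.det (1 + (X : R[X]) • (-M).map C) with hq
  have hpq : q = p.comp (-X) := by
    have h := (compRingHom (-X : R[X])).map_det (1 + (X : R[X]) • M.map C)
    rw [coe_compRingHom_apply] at h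
    rw [hp, h, hq]
    congr 1
    ext i j : 2
    by_cases hij : i = j <;> simp [hij]
  have hmul : p * q = Matrix.det (1 + (X ^ 2 : R[X]) • (-(M * M)).map C) := by
    rw [hp, hq, ← Matrix.det_mul]
    congr 1
    have h1 : ((-M).map C : Matrix ι ι R[X]) = -(M.map C) := by ext; simp
    have h2 : ((-(M * M)).map C : Matrix ι ι R[X]) = -(M.map C * M.map C) := by
      rw [← Matrix.map_mul]; ext i j : 2; simp [-Matrix.map_mul]
    rw [h1, h2]
    simp only [mul_add, add_mul, one_mul, mul_one, smul_neg, mul_neg, Matrix.smul_mul,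
      Matrix.mul_smul, smul_smul, pow_two]
    abel
  have h2 := Matrix.det_one_add_smul (X ^ 2 : R[X]) ((-(M * M)).map C)
  rw [← hmul] at h2
  have c0 : p.coeff 0 = 1 := by
    rw [hp, Matrix.det_one_add_X_smul]
    simp
  have c1 : p.coeff 1 = M.trace := Matrix.coeff_det_one_add_X_smul_one M
  have e := congrArg (fun f => coeff f 2) h2
  have tr : (((-(M * M)).map C : Matrix ι ι R[X])).trace = C (-(M * M).trace) := by
    simp [Matrix.trace]
  rw [tr] at e
  have hq' : ∀ j, q.coeff j = (-1) ^ j * p.coeff j := by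
    intro j
    rw [hpq, show (-X : R[X]) = C (-1) * X by simp, comp_C_mul_X_coeff, mul_comm]
  have e' : (p * q).coeff 2 = -(M * M).trace := by
    rw [e, ← pow_mul, coeff_add, coeff_add, coeff_C_mul, coeff_mul_X_pow', coeff_X_pow]
    simp [coeff_one]
  rw [coeff_mul] at e'
  simp only [Finset.Nat.antidiagonal_succ, Finset.Nat.antidiagonal_zero, hq'] at e'
  simp [c0, c1] at e'
  linear_combination e'

open Polynomial in
/-- Second-order expansion of the determinant around a diagonal matrix. -/
lemma Matrix.exists_two_mul_det_diagonal_add_smul {R ι : Type*} [CommRing R] [IsDomain R]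
    [Fintype ι] [DecidableEq ι] (d : ι → R) (hd : ∀ i, d i ≠ 0) (N : Matrix ι ι R) (t : R) :
    ∃ r : R, 2 * (Matrix.diagonal d + t • N).det =
      2 * ∏ i, d i + 2 * t * ∑ a, (∏ i ∈ Finset.univ.erase a, d i) * N a a +
      t ^ 2 * ∑ a, ∑ c ∈ Finset.univ.erase a,
        (∏ i ∈ (Finset.univ.erase a).erase c, d i) * (N a a * N c c - N a c * N c a) +
      t ^ 3 * r := by
  set P : R[X] := Matrix.det (Matrix.diagonal (fun i => C (d i)) + (X : R[X]) • N.map C) with hP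
  obtain ⟨K, _, f, hf⟩ : ∃ (K : Type _) (_ : Field K) (f : R →+* K), Function.Injective f :=
    ⟨FractionRing R, inferInstance, algebraMap R _, IsFractionRing.injective R _⟩
  have hfd : ∀ i, f (d i) ≠ 0 := fun i h => hd i (hf (by simpa using h))
  let M : Matrix ι ι K := Matrix.diagonal (fun i => (f (d i))⁻¹) * N.map f
  have hM : ∀ i j, M i j = (f (d i))⁻¹ * f (N i j) := by
    intro i j; simp [M]
  have hPM : P.map f = C (∏ i, f (d i)) * Matrix.det (1 + (X : K[X]) • M.map C) := by
    have h1 : P.map f = Matrix.det (Matrix.diagonal (fun i => C (f (d i))) *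
        (1 + (X : K[X]) • M.map C)) := by
      rw [hP, ← coe_mapRingHom, RingHom.map_det]
      congr 1
      ext i j : 2
      rw [Matrix.diagonal_mul]
      by_cases hij : i = j
      · subst hij
        simp [hM, mul_add, ← C_mul, ← mul_assoc, hfd, -map_mul]
      · simp [hM, hij, ← C_mul, ← mul_assoc, hfd, -map_mul]
    rw [h1, Matrix.det_mul, Matrix.det_diagonal, map_prod]
  have p1 : ∀ a, (∏ i, f (d i)) * (f (d a))⁻¹ = ∏ i ∈ Finset.univ.erase a, f (d i) := by
    intro a
    rw [← Finset.mul_prod_erase _ _ (Finset.mem_univ a)]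
    field_simp [hfd a]
  have p2 : ∀ a, ∀ c ∈ Finset.univ.erase a, (∏ i, f (d i)) * ((f (d a))⁻¹ * (f (d c))⁻¹) =
      ∏ i ∈ (Finset.univ.erase a).erase c, f (d i) := by
    intro a c hc
    rw [← mul_assoc, p1, ← Finset.mul_prod_erase _ _ hc]
    field_simp [hfd c]
  have e0 : P.coeff 0 = ∏ i, d i := by
    apply hf
    rw [← coeff_map, hPM, coeff_C_mul, Matrix.det_one_add_X_smul]
    simp
  have e1 : P.coeff 1 = ∑ a, (∏ i ∈ Finset.univ.erase a, d i) * N a a := by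
    apply hf
    rw [← coeff_map, hPM, coeff_C_mul, Matrix.coeff_det_one_add_X_smul_one]
    simp only [Matrix.trace, Matrix.diag_apply, hM, Finset.mul_sum, map_sum, map_mul, map_prod]
    exact Finset.sum_congr rfl fun a _ => by rw [← mul_assoc, p1]
  have e2 : 2 * P.coeff 2 = ∑ a, ∑ c ∈ Finset.univ.erase a,
        (∏ i ∈ (Finset.univ.erase a).erase c, d i) * (N a a * N c c - N a c * N c a) := by
    apply hf
    rw [map_mul, ← coeff_map, hPM, coeff_C_mul, mul_left_comm, map_ofNat,
      Matrix.two_mul_coeff_det_one_add_X_smul_two]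
    simp only [Matrix.trace, Matrix.diag_apply, Matrix.mul_apply, hM]
    rw [sq, Finset.sum_mul_sum, ← Finset.sum_sub_distrib, Finset.mul_sum, map_sum]
    refine Finset.sum_congr rfl fun a _ => ?_
    rw [← Finset.sum_sub_distrib, ← Finset.add_sum_erase _ _ (Finset.mem_univ a), sub_self,
      zero_add, Finset.mul_sum, map_sum]
    refine Finset.sum_congr rfl fun c hc => ?_
    simp only [map_mul, map_sub, map_prod]
    rw [← p2 a c hc]
    ring
  have hdet : (Matrix.diagonal d + t • N).det = P.eval t := by
    rw [hP, ← coe_evalRingHom, RingHom.map_det]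
    congr 1
    ext i j : 2
    by_cases hij : i = j <;> simp [hij, (mul_comm t (N _ _)).symm]
  refine ⟨2 * P.divX.divX.divX.eval t, ?_⟩
  have h3 : P = ((P.divX.divX.divX * X + C (P.coeff 2)) * X + C (P.coeff 1)) * X
      + C (P.coeff 0) := by
    conv_lhs => rw [← divX_mul_X_add P, ← divX_mul_X_add P.divX, ← divX_mul_X_add P.divX.divX]
    simp [coeff_divX]
  rw [hdet, ← e0, ← e1, ← e2]
  conv_lhs => rw [h3]
  simp
  ring

lemma sigmaE_zero {ι : Type*} (s : Finset ι) (κ : ι → ℝ) : sigmaE s 0 κ = 1 := by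
  simp [sigmaE]

lemma sigmaE_of_neg {ι : Type*} (s : Finset ι) {j : ℤ} (hj : j < 0) (κ : ι → ℝ) :
    sigmaE s j κ = 0 := by
  simp [sigmaE, hj]

lemma sigmaE_natCast {ι : Type*} (s : Finset ι) (k : ℕ) (κ : ι → ℝ) :
    sigmaE s (k : ℤ) κ = ∑ t ∈ s.powersetCard k, ∏ i ∈ t, κ i := by
  simp [sigmaE]

lemma sigmaE_insert {ι : Type*} [DecidableEq ι] {s : Finset ι} {a : ι} (ha : a ∉ s) (j : ℤ)
    (κ : ι → ℝ) :
    sigmaE (insert a s) j κ = sigmaE s j κ + κ a * sigmaE s (j - 1) κ := by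
  rcases lt_trichotomy j 0 with hj | rfl | hj
  · simp [sigmaE_of_neg, hj, show j - 1 < 0 by lia]
  · simp [sigmaE_zero, sigmaE_of_neg]
  · obtain ⟨m, rfl⟩ : ∃ m : ℕ, j = ((m + 1 : ℕ) : ℤ) := ⟨(j - 1).toNat, by lia⟩
    rw [show (((m + 1 : ℕ) : ℤ) - 1) = (m : ℤ) by push_cast; ring]
    simp only [sigmaE_natCast]
    rw [Finset.powersetCard_succ_insert ha, Finset.sum_union, Finset.sum_image, Finset.mul_sum]
    · congr 1
      refine Finset.sum_congr rfl fun t ht => Finset.prod_insert fun hat => ?_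
      exact ha ((Finset.mem_powersetCard.1 ht).1 hat)
    · intro t ht u hu h
      have hat : a ∉ t := fun h => ha ((Finset.mem_powersetCard.1 ht).1 h)
      have hau : a ∉ u := fun h => ha ((Finset.mem_powersetCard.1 hu).1 h)
      rw [← Finset.erase_insert hat, ← Finset.erase_insert hau]
      exact congrArg (fun v => Finset.erase v a) h
    · rw [Finset.disjoint_left]
      rintro t ht hti
      obtain ⟨u, _, rfl⟩ := Finset.mem_image.1 hti
      exact ha ((Finset.mem_powersetCard.1 ht).1 (Finset.mem_insert_self a u))

lemma sigmaE_eq_erase_add {ι : Type*} [DecidableEq ι] {s : Finset ι} {a : ι} (ha : a ∈ s) (j : ℤ)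
    (κ : ι → ℝ) :
    sigmaE s j κ = sigmaE (s.erase a) j κ + κ a * sigmaE (s.erase a) (j - 1) κ := by
  conv_lhs => rw [← Finset.insert_erase ha]
  exact sigmaE_insert (Finset.notMem_erase a s) j κ

lemma sigmaV_pos {ι : Type*} [Fintype ι] {k : ℕ} (hk : k ≤ Fintype.card ι) {κ : ι → ℝ}
    (hκ : ∀ i, 0 < κ i) : 0 < sigmaV (k : ℤ) κ := by
  rw [sigmaV, sigmaE_natCast]
  refine Finset.sum_pos (fun t _ => Finset.prod_pos fun i _ => hκ i) ?_
  exact Finset.powersetCard_nonempty.2 (by simpa using hk)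

open Polynomial in
lemma coeff_prod_X_add_C {ι : Type*} (s : Finset ι) (l : ι → ℝ) (hl : ∀ i, l i ≠ 0) (k : ℕ) :
    (∏ i ∈ s, (X + C (l i))).coeff k = (∏ i ∈ s, l i) * sigmaE s (k : ℤ) (fun i => (l i)⁻¹) := by
  induction s using Finset.induction_on generalizing k with
  | empty =>
    rcases k with _ | k
    · simp [sigmaE_zero]
    · rw [sigmaE_natCast, Finset.powersetCard_eq_empty.2 (by simp)]
      simp [coeff_one]
  | insert a s ha ih =>
    rw [Finset.prod_insert ha, Finset.prod_insert ha, sigmaE_insert ha, add_mul, coeff_add,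
      coeff_C_mul, ih]
    rcases k with _ | k
    · simp [sigmaE_of_neg, mul_assoc]
    · rw [coeff_X_mul, ih, show (((k + 1 : ℕ) : ℤ) - 1) = (k : ℤ) by push_cast; ring]
      field_simp [hl a]
      ring

open Polynomial in
lemma sigmaMat_eq_coeff_det {n k : ℕ} (hk : k ≤ n) {A : Matrix (Fin n) (Fin n) ℝ}
    (hA : A.IsHermitian) :
    sigmaMat ((n : ℤ) - k) A = (Matrix.det ((X : ℝ[X]) • 1 + A.map C)).coeff k := by
  have h : Matrix.det ((X : ℝ[X]) • 1 + A.map C) = ∏ i, (X + C (hA.eigenvalues i)) := by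
    have h1 := congrArg (fun p => (-1) ^ n * compRingHom (-X : ℝ[X]) p) hA.charpoly_eq
    simp only [Matrix.charpoly, RingHom.map_det, map_prod] at h1
    convert h1 using 1
    · have h2 : (compRingHom (-X : ℝ[X])).mapMatrix A.charmatrix =
          -((X : ℝ[X]) • 1 + A.map C) := by
        ext i j : 2
        by_cases hij : i = j
        · subst hij
          simp
          ring
        · simp [hij, Matrix.charmatrix_apply_ne]
      rw [h2, Matrix.det_neg, Fintype.card_fin, ← mul_assoc, ← mul_pow]
      simp
    · have h2 : ∀ i, compRingHom (-X : ℝ[X]) (X - C ((hA.eigenvalues i : ℝ))) =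
          -1 * (X + C (hA.eigenvalues i)) := by
        intro i
        simp
        ring
      simp only [RCLike.ofReal_real_eq_id, id, h2, Finset.prod_mul_distrib, Finset.prod_const,
        Finset.card_univ, Fintype.card_fin]
      rw [← mul_assoc, ← mul_pow]
      simp
  rw [h, Finset.prod_X_add_C_coeff _ _ (by simpa using hk), sigmaMat, dif_pos hA, sigmaV,
    ← Nat.cast_sub hk, sigmaE_natCast]
  simp

open Polynomial in
/-- Along the line `diag(l) + t ξ`, the function `σ_{n-k}` is a polynomial in `t`; its coefficients
up to order two are expressed through the reciprocals of `l`. -/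
lemma exists_polynomial_sigmaMat {n k : ℕ} (hk : k ≤ n) (l : Fin n → ℝ) (hl : ∀ i, l i ≠ 0)
    (ξ : Matrix (Fin n) (Fin n) ℝ) (hξ : ξ.IsSymm) (κ : Fin n → ℝ) (hκ : ∀ i, κ i = (l i)⁻¹) :
    ∃ p : ℝ[X], (∀ t : ℝ, sigmaMat ((n : ℤ) - k) (Matrix.diagonal l + t • ξ) = p.eval t) ∧
      p.coeff 0 = (∏ i, l i) * sigmaV (k : ℤ) κ ∧
      p.coeff 1 = (∏ i, l i) * ∑ a, sigmaV1 (k : ℤ) κ a * κ a * ξ a a ∧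
      2 * p.coeff 2 = (∏ i, l i) * ∑ a, ∑ c ∈ Finset.univ.erase a,
        sigmaV2 (k : ℤ) κ a c * κ a * κ c * (ξ a a * ξ c c - ξ a c ^ 2) := by
  obtain rfl : κ = fun i => (l i)⁻¹ := funext hκ
  let d : Fin n → ℝ[X][X] := fun i => X + C (C (l i))
  let N : Matrix (Fin n) (Fin n) ℝ[X][X] := ξ.map fun x => C (C x)
  have hd : ∀ i, d i ≠ 0 := fun i => X_add_C_ne_zero _
  obtain ⟨r, hr⟩ := Matrix.exists_two_mul_det_diagonal_add_smul d hd N (C X)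
  set Q := (Matrix.diagonal d + (C X : ℝ[X][X]) • N).det with hQ
  have hprod : ∀ s : Finset (Fin n), (∏ i ∈ s, d i).coeff k =
      C ((∏ i ∈ s, l i) * sigmaE s (k : ℤ) (fun i => (l i)⁻¹)) := by
    intro s
    rw [← coeff_prod_X_add_C s l hl, ← coeff_map, Polynomial.map_prod]
    simp [d]
  have hrk := congrArg (fun q => coeff q k) hr
  have e1 : ∀ a, (∏ i ∈ Finset.univ.erase a, l i) = (∏ i, l i) * (l a)⁻¹ := by
    intro a
    rw [← Finset.mul_prod_erase _ _ (Finset.mem_univ a)]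
    field_simp [hl a]
  have e2 : ∀ a, ∀ c ∈ Finset.univ.erase a, (∏ i ∈ (Finset.univ.erase a).erase c, l i) =
      (∏ i, l i) * (l a)⁻¹ * (l c)⁻¹ := by
    intro a c hc
    rw [← e1, ← Finset.mul_prod_erase _ _ hc]
    field_simp [hl c]
  have s1 : (∑ a, (∏ i ∈ Finset.univ.erase a, d i) * N a a).coeff k =
      C ((∏ i, l i) * ∑ a, sigmaV1 (k : ℤ) (fun i => (l i)⁻¹) a * (l a)⁻¹ * ξ a a) := by
    rw [finsetSum_coeff, Finset.mul_sum, map_sum]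
    refine Finset.sum_congr rfl fun a _ => ?_
    rw [show N a a = C (C (ξ a a)) from rfl, coeff_mul_C, hprod, ← C_mul, e1, sigmaV1]
    congr 1
    ring
  have s2 : (∑ a, ∑ c ∈ Finset.univ.erase a, (∏ i ∈ (Finset.univ.erase a).erase c, d i) *
        (N a a * N c c - N a c * N c a)).coeff k =
      C ((∏ i, l i) * ∑ a, ∑ c ∈ Finset.univ.erase a, sigmaV2 (k : ℤ) (fun i => (l i)⁻¹) a c *
        (l a)⁻¹ * (l c)⁻¹ * (ξ a a * ξ c c - ξ a c ^ 2)) := by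
    rw [finsetSum_coeff, Finset.mul_sum, map_sum]
    refine Finset.sum_congr rfl fun a _ => ?_
    rw [finsetSum_coeff, Finset.mul_sum, map_sum]
    refine Finset.sum_congr rfl fun c hc => ?_
    have hN : N a a * N c c - N a c * N c a = C (C (ξ a a * ξ c c - ξ a c ^ 2)) := by
      simp only [N, Matrix.map_apply, ← C_mul, ← C_sub, hξ.apply a c, sq]
    rw [hN, coeff_mul_C, hprod, ← C_mul, e2 a c hc, sigmaV2]
    congr 1
    ring
  have hmain : C 2 * Q.coeff k = C 2 * C ((∏ i, l i) * sigmaV (k : ℤ) (fun i => (l i)⁻¹)) +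
      C 2 * (C ((∏ i, l i) * ∑ a, sigmaV1 (k : ℤ) (fun i => (l i)⁻¹) a * (l a)⁻¹ * ξ a a) * X ^ 1)
      + C ((∏ i, l i) * ∑ a, ∑ c ∈ Finset.univ.erase a, sigmaV2 (k : ℤ) (fun i => (l i)⁻¹) a c *
        (l a)⁻¹ * (l c)⁻¹ * (ξ a a * ξ c c - ξ a c ^ 2)) * X ^ 2 + r.coeff k * X ^ 3 := by
    have h2 : (2 : ℝ[X][X]) = C (C 2) := by rw [C_ofNat, C_ofNat]
    simp only [h2, coeff_add] at hrk
    rw [mul_assoc (C (C 2)) (C X), ← C_pow, ← C_pow, coeff_C_mul, coeff_C_mul, coeff_C_mul,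
      coeff_C_mul, coeff_C_mul, coeff_C_mul, hprod, s1, s2] at hrk
    rw [hrk, sigmaV]
    ring
  refine ⟨Q.coeff k, fun t => ?_, ?_, ?_, ?_⟩
  · have hH : (Matrix.diagonal l + t • ξ).IsHermitian := by
      ext i j
      by_cases hij : i = j
      · simp [hij]
      · simp [hij, Ne.symm hij, hξ.apply i j]
    rw [sigmaMat_eq_coeff_det hk hH, ← coe_evalRingHom, ← coeff_map, ← coe_mapRingHom, hQ,
      RingHom.map_det]
    congr 2
    ext i j : 2
    by_cases hij : i = j
    · subst hij
      simp [d, N, add_assoc]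
    · simp [d, N, hij]
  · have := congrArg (fun q => coeff q 0) hmain
    simp only [coeff_add, coeff_C_mul, coeff_mul_X_pow', coeff_C] at this
    norm_num at this
    exact this
  · have := congrArg (fun q => coeff q 1) hmain
    simp only [coeff_add, coeff_C_mul, coeff_mul_X_pow', coeff_C] at this
    norm_num at this
    exact this
  · have := congrArg (fun q => coeff q 2) hmain
    simp only [coeff_add, coeff_C_mul, coeff_mul_X_pow', coeff_C] at this
    norm_num [-Finset.sum_erase_eq_sub] at this
    exact this

open Polynomial in
lemma iteratedDeriv_two_eval_div_eval_s5 (p q : ℝ[X]) (hq : q.coeff 0 ≠ 0) :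
    iteratedDeriv 2 (fun t : ℝ => p.eval t / q.eval t) 0 =
      2 * p.coeff 2 / q.coeff 0 - p.coeff 0 * (2 * q.coeff 2) / q.coeff 0 ^ 2
        - 2 * q.coeff 1 * (p.coeff 1 * q.coeff 0 - p.coeff 0 * q.coeff 1) / q.coeff 0 ^ 3 := by
  have hq0 : q.eval 0 ≠ 0 := by rwa [← coeff_zero_eq_eval_zero]
  have hd : deriv (fun t : ℝ => p.eval t / q.eval t) =ᶠ[nhds 0] fun t =>
      (p.derivative * q - p * q.derivative).eval t / (q ^ 2).eval t := by
    filter_upwards [q.continuous.continuousAt.eventually_ne hq0] with t ht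
    rw [((p.hasDerivAt t).fun_div (q.hasDerivAt t) ht).deriv]
    simp
  rw [iteratedDeriv_succ, iteratedDeriv_one, hd.deriv_eq,
    ((Polynomial.hasDerivAt _ 0).fun_div (Polynomial.hasDerivAt _ 0) (by simpa using hq0)).deriv]
  have h1 : ∀ f : ℝ[X], f.derivative.eval 0 = f.coeff 1 := by
    intro f; simp [← coeff_zero_eq_eval_zero, coeff_derivative]
  have h2 : ∀ f : ℝ[X], f.derivative.coeff 1 = 2 * f.coeff 2 := by
    intro f
    rw [coeff_derivative]
    push_cast
    ring
  simp only [derivative_sub, derivative_mul, derivative_pow, eval_sub, eval_mul, eval_add, eval_pow,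
    h1, h2, ← coeff_zero_eq_eval_zero]
  simp
  field_simp
  ring

lemma sum_sigmaV1_sub_one_mul_sq {ι : Type*} [Fintype ι] [DecidableEq ι] (j : ℤ) (κ : ι → ℝ)
    (ξ : Matrix ι ι ℝ) :
    ∑ α, sigmaV1 (j - 1) κ α * κ α ^ 2 * ξ α α =
      sigmaV j κ * ∑ α, κ α * ξ α α - ∑ α, sigmaV1 j κ α * κ α * ξ α α := by
  rw [Finset.mul_sum, ← Finset.sum_sub_distrib]
  refine Finset.sum_congr rfl fun α _ => ?_
  rw [sigmaV, sigmaV1, sigmaV1, sigmaE_eq_erase_add (Finset.mem_univ α)]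
  ring

lemma sum_sigmaV2_sub_two_add {ι : Type*} [Fintype ι] [DecidableEq ι] (j : ℤ) (κ : ι → ℝ)
    (ξ : Matrix ι ι ℝ) (hξ : ξ.IsSymm) :
    ∑ α, ∑ γ ∈ Finset.univ.erase α, sigmaV2 (j - 2) κ α γ * κ α ^ 2 * κ γ ^ 2 *
        (ξ α α * ξ γ γ - ξ α γ ^ 2) +
      2 * ∑ α, ∑ γ, sigmaV1 (j - 1) κ α * κ α ^ 2 * κ γ * ξ α γ ^ 2 =
    ∑ α, ∑ γ ∈ Finset.univ.erase α, sigmaV2 j κ α γ * κ α * κ γ * (ξ α α * ξ γ γ - ξ α γ ^ 2) -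
      sigmaV j κ * ∑ α, ∑ γ ∈ Finset.univ.erase α, κ α * κ γ * (ξ α α * ξ γ γ - ξ α γ ^ 2) +
      2 * (∑ α, κ α * ξ α α) * ∑ α, sigmaV1 (j - 1) κ α * κ α ^ 2 * ξ α α := by
  set g : ι → ι → ℝ := fun α γ =>
    sigmaV1 (j - 1) κ α * κ α ^ 2 * κ γ * (ξ α α * ξ γ γ - ξ α γ ^ 2) with hg
  have hpt : ∀ α, ∀ γ ∈ Finset.univ.erase α,
      sigmaV2 (j - 2) κ α γ * κ α ^ 2 * κ γ ^ 2 * (ξ α α * ξ γ γ - ξ α γ ^ 2) =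
      sigmaV2 j κ α γ * κ α * κ γ * (ξ α α * ξ γ γ - ξ α γ ^ 2) -
      sigmaV j κ * (κ α * κ γ * (ξ α α * ξ γ γ - ξ α γ ^ 2)) + (g α γ + g γ α) := by
    intro α γ hγ
    have hα : α ∈ Finset.univ.erase γ := by
      simpa [eq_comm] using hγ
    have h1 := sigmaE_eq_erase_add (Finset.mem_univ α) j κ
    have h2 := sigmaE_eq_erase_add hγ j κ
    have h3 := sigmaE_eq_erase_add hγ (j - 1) κ
    have h4 := sigmaE_eq_erase_add hα (j - 1) κ
    rw [Finset.erase_right_comm] at h4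
    rw [show j - 1 - 1 = j - 2 by ring] at h3 h4
    simp only [hg, sigmaV, sigmaV1, sigmaV2, hξ.apply α γ]
    rw [h1, h2, h4, h3]
    ring
  have hdiag : ∀ α, ∑ γ ∈ Finset.univ.erase α, (g α γ + g γ α) = ∑ γ, (g α γ + g γ α) := by
    intro α
    rw [← Finset.add_sum_erase _ _ (Finset.mem_univ α)]
    simp only [hg]
    ring
  have hsum : ∑ α, ∑ γ, (g α γ + g γ α) = 2 * ∑ α, ∑ γ, g α γ := by
    simp only [Finset.sum_add_distrib]
    rw [Finset.sum_comm (f := fun α γ => g γ α)]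
    ring
  have hprod : ∑ α, ∑ γ, g α γ +
      ∑ α, ∑ γ, sigmaV1 (j - 1) κ α * κ α ^ 2 * κ γ * ξ α γ ^ 2 =
      (∑ α, κ α * ξ α α) * ∑ α, sigmaV1 (j - 1) κ α * κ α ^ 2 * ξ α α := by
    rw [mul_comm, Finset.sum_mul_sum, ← Finset.sum_add_distrib]
    refine Finset.sum_congr rfl fun α _ => ?_
    rw [← Finset.sum_add_distrib]
    refine Finset.sum_congr rfl fun γ _ => ?_
    simp only [hg]
    ring
  rw [Finset.sum_congr rfl fun α _ => Finset.sum_congr rfl (hpt α)]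
  simp only [Finset.sum_add_distrib (f := fun γ => _ - _), Finset.sum_sub_distrib, hdiag,
    ← Finset.mul_sum]
  rw [hsum]
  linear_combination 2 * hprod

/-- second derivative of the Hessian quotient `F = σ_n/σ_{n-k}` at a
positive diagonal matrix `W = diag(λ)` in a symmetric direction `ξ`, `κ_α = 1/λ_α`:
`σ_k(κ)² (d²/dt²)|₀ F(W+tξ) = -Σ_{α≠γ} σ_{k-2}(κ|αγ) κ_α²κ_γ² (ξ_{αα}ξ_{γγ} - ξ_{αγ}²)
 - 2 Σ_{α,γ} σ_{k-1}(κ|α) κ_α²κ_γ ξ_{αγ}² + 2 (Σ_α σ_{k-1}(κ|α) κ_α² ξ_{αα})²/σ_k(κ)`. -/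
theorem stmt_5 (n k : ℕ) (hn : 2 ≤ n) (hk1 : 1 ≤ k) (hk2 : k ≤ n - 1)
    (lam : Fin n → ℝ) (hpos : ∀ α, 0 < lam α)
    (ξ : Matrix (Fin n) (Fin n) ℝ) (hξ : ξ.IsSymm) :
    let W : Matrix (Fin n) (Fin n) ℝ := Matrix.diagonal lam
    let κ : Fin n → ℝ := fun α => (lam α)⁻¹
    (sigmaV (k : ℤ) κ) ^ 2 * iteratedDeriv 2 (fun t : ℝ => Fquot k (W + t • ξ)) 0
      = -(∑ α, ∑ γ ∈ Finset.univ.erase α,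
            sigmaV2 ((k : ℤ) - 2) κ α γ * (κ α) ^ 2 * (κ γ) ^ 2 *
              (ξ α α * ξ γ γ - (ξ α γ) ^ 2))
        - 2 * ∑ α, ∑ γ, sigmaV1 ((k : ℤ) - 1) κ α * (κ α) ^ 2 * κ γ * (ξ α γ) ^ 2
        + 2 * (∑ α, sigmaV1 ((k : ℤ) - 1) κ α * (κ α) ^ 2 * ξ α α) ^ 2
            / sigmaV (k : ℤ) κ := by
  intro W κ
  have hl : ∀ i, lam i ≠ 0 := fun i => (hpos i).ne'
  have hS : 0 < sigmaV (k : ℤ) κ :=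
    sigmaV_pos (by rw [Fintype.card_fin]; lia) fun i => inv_pos.2 (hpos i)
  have hP : 0 < ∏ i, lam i := Finset.prod_pos fun i _ => hpos i
  obtain ⟨p, hp, p0, p1, p2⟩ :=
    exists_polynomial_sigmaMat (Nat.zero_le n) lam hl ξ hξ κ fun _ => rfl
  obtain ⟨q, hq, q0, q1, q2⟩ :=
    exists_polynomial_sigmaMat (show k ≤ n by lia) lam hl ξ hξ κ fun _ => rfl
  have hF : (fun t : ℝ => Fquot k (W + t • ξ)) = fun t => p.eval t / q.eval t := by
    funext t
    rw [Fquot, ← hp, ← hq, Nat.cast_zero, sub_zero]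
  rw [hF, iteratedDeriv_two_eval_div_eval_s5 p q (by rw [q0]; positivity), p2, q2, p0, p1, q0, q1]
  have hD := sum_sigmaV1_sub_one_mul_sq k κ ξ
  have hAB := sum_sigmaV2_sub_two_add k κ ξ hξ
  simp only [sigmaV, sigmaV1, sigmaV2, Nat.cast_zero, sigmaE_zero, one_mul, mul_one]
    at hD hAB hS ⊢
  set S := sigmaE Finset.univ (k : ℤ) κ
  rw [hD] at hAB ⊢
  rw [eq_sub_of_add_eq hAB]
  field_simp
  ring
end
end
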